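/- Let N ≥ 3 be an integer and p > 1 a real number, and if N ≥ 11 assume additionally that p < p_c. Then there exists a constant C* > 0, depending only on N and p, with the following property: if a : ℝ^N → ℝ^N is a smooth divergence-free vector field satisfying |a(x)| ≤ C/(|x|+1) for all x ∈ ℝ^N for some constant 0 < C ≤ C*, then the equation −Δu + a(x)·∇u = u^p admits no positive stable solution on ℝ^N. -/

import Mathlib

open MeasureTheory Real Filter
open scoped InnerProductSpace ENNReal Topology

noncomputable section

/-- Euclidean space ℝ^N. -/
abbrev Euc (N : ℕ) := EuclideanSpace ℝ (Fin N)

/-- The Laplacian of a real-valued function on ℝ^N, as the sum of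
the second partial derivatives in the coordinate directions. -/
def lap {N : ℕ} (u : Euc N → ℝ) (x : Euc N) : ℝ :=
  ∑ i : Fin N,
    fderiv ℝ (fun y => fderiv ℝ u y (EuclideanSpace.single i 1)) x
      (EuclideanSpace.single i 1)

/-- The divergence of a vector field on ℝ^N. -/
def divg {N : ℕ} (a : Euc N → Euc N) (x : Euc N) : ℝ :=
  ∑ i : Fin N, fderiv ℝ a x (EuclideanSpace.single i 1) i

/-- The advection term `a(x) · ∇u(x)`. -/
def adv {N : ℕ} (a : Euc N → Euc N) (u : Euc N → ℝ) (x : Euc N) : ℝ :=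
  ⟪a x, gradient u x⟫_ℝ

/-- `u` is a positive smooth solution of `-Δu + a(x)·∇u = u^p` in the open set `Ω`. -/
def IsSolution {N : ℕ} (a : Euc N → Euc N) (p : ℝ) (Ω : Set (Euc N))
    (u : Euc N → ℝ) : Prop :=
  ContDiffOn ℝ (⊤ : ℕ∞) u Ω ∧ (∀ x ∈ Ω, 0 < u x) ∧
    ∀ x ∈ Ω, -lap u x + adv a u x = u x ^ p

/-- `u` is a stable solution of `-Δu + a(x)·∇u = u^p` in `Ω`: it is a positive smooth
solution and there is a smooth positive `E` with `-ΔE + a(x)·∇E ≥ p u^(p-1) E` in `Ω`. -/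
def IsStableSolution {N : ℕ} (a : Euc N → Euc N) (p : ℝ) (Ω : Set (Euc N))
    (u : Euc N → ℝ) : Prop :=
  IsSolution a p Ω u ∧
    ∃ E : Euc N → ℝ, ContDiffOn ℝ (⊤ : ℕ∞) E Ω ∧ (∀ x ∈ Ω, 0 < E x) ∧
      ∀ x ∈ Ω, p * u x ^ (p - 1) * E x ≤ -lap E x + adv a E x

/-- The Joseph–Lundgren exponent for `N ≥ 11`. -/
def pJL (N : ℕ) : ℝ :=
  (((N : ℝ) - 2) ^ 2 - 4 * N + 8 * Real.sqrt ((N : ℝ) - 1)) /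
    (((N : ℝ) - 2) * ((N : ℝ) - 10))


lemma param_exists (N : ℕ) (p : ℝ) (hp : 1 < p)
    (hpc : 11 ≤ N → p < pJL N) :
    ∃ t : ℝ, 1 < t ∧ t ^ 2 < p * (2 * t - 1) ∧ (N : ℝ) < 2 + 4 * t / (p - 1) := by
  have hp1 : 0 < p - 1 := by linarith
  rcases le_or_gt N 10 with h10 | h11
  · have hN : (N : ℝ) ≤ 10 := by exact_mod_cast h10
    refine ⟨2 * p - 1, by linarith, by nlinarith, ?_⟩
    have : 8 < 4 * (2 * p - 1) / (p - 1) := by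
      rw [lt_div_iff₀ hp1]; linarith
    linarith
  · have h := hpc h11
    have hN : (11 : ℝ) ≤ N := by exact_mod_cast h11
    obtain ⟨m, hm⟩ : ∃ m : ℝ, m = (N : ℝ) - 2 := ⟨_, rfl⟩
    have hm9 : 9 ≤ m := by linarith
    obtain ⟨q, hq⟩ : ∃ q : ℝ, q = Real.sqrt (m + 1) := ⟨_, rfl⟩
    have hq0 : 0 < q := by rw [hq]; exact Real.sqrt_pos.mpr (by linarith)
    have hq2 : q ^ 2 = m + 1 := by rw [hq]; exact Real.sq_sqrt (by linarith)
    have hJ : p * (m * (m - 8)) < m ^ 2 - 4 * m - 8 + 8 * q := by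
      rw [pJL, lt_div_iff₀ (by nlinarith)] at h
      rw [hq, hm]
      have e : (N : ℝ) - 2 + 1 = N - 1 := by ring
      rw [e]
      linarith
    -- the critical value
    set t0 := max p (m * (p - 1) / 4) with ht0
    have hf : t0 ^ 2 < p * (2 * t0 - 1) := by
      rcases le_total (m * (p - 1) / 4) p with h1 | h1
      · rw [ht0, max_eq_left h1]; nlinarith
      · rw [ht0, max_eq_right h1]
        have hlow : m ≤ (m - 4) * p := by linarith
        have hpl : m ^ 2 - 4 * m - 8 - 8 * q < p * (m * (m - 8)) := by
          have : m ^ 2 - 8 * m ≤ p * ((m-4) * (m - 8)) := by nlinarith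
          have h3 : m * (m ^ 2 - 8 * m) ≤ p * (m * (m - 8)) * (m-4) := by nlinarith
          have h4 : (m ^ 2 - 4 * m - 8 - 8 * q) * (m - 4) < m * (m ^ 2 - 8 * m) := by
            nlinarith [mul_pos hq0 (by linarith : 0 < m - 4)]
          have : (m ^ 2 - 4 * m - 8 - 8 * q) * (m - 4) < p * (m * (m - 8)) * (m-4) := by linarith
          exact lt_of_mul_lt_mul_right this (by linarith)
        have hprod := mul_pos (sub_pos.mpr hJ) (sub_pos.mpr hpl)
        have hquad : (m * (m - 8)) * (m * (m - 8) * p ^ 2 - (2 * m ^ 2 - 8 * m - 16) * p + m ^ 2) < 0 := by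
          have e : (m * (m - 8)) * (m * (m - 8) * p ^ 2 - (2 * m ^ 2 - 8 * m - 16) * p + m ^ 2)
            = -((m ^ 2 - 4 * m - 8 + 8 * q - p * (m * (m - 8))) * (p * (m * (m - 8)) - (m ^ 2 - 4 * m - 8 - 8 * q))) - 64 * ((m+1) - q^2) := by ring
          rw [e, hq2]; linarith
        have := neg_of_mul_neg_right hquad (by nlinarith)
        nlinarith
    have hcont : ContinuousAt (fun t : ℝ => p * (2 * t - 1) - t ^ 2) t0 := by fun_prop
    have hev : ∀ᶠ t in 𝓝 t0, 0 < p * (2 * t - 1) - t ^ 2 :=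
      hcont.eventually (lt_mem_nhds (by simpa using sub_pos.mpr hf))
    obtain ⟨ε, hε, hb⟩ := Metric.eventually_nhds_iff.mp hev
    have hb' := @hb (t0 + ε / 2) (by simp [abs_of_pos hε]; linarith)
    have hp0 : p ≤ t0 := le_max_left _ _
    have hp0' : m * (p-1)/4 ≤ t0 := le_max_right _ _
    refine ⟨t0 + ε / 2, by linarith, by linarith, ?_⟩
    have : m < 4 * (t0 + ε / 2) / (p - 1) := by
      rw [lt_div_iff₀ hp1]; linarith
    linarith

lemma coord1 (t θ K b w g h : ℝ) (hθ : 0 < θ) (hK1 : 2 * (t ^ 2 / θ + 1) ≤ K) :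
    b * w + (2 * (t * g + h) * w - w ^ 2) ≤ (t ^ 2 + θ) * g ^ 2 + K * (h ^ 2 + b ^ 2) := by
  have e1 : b * w + (2 * (t * g + h) * w - w ^ 2) ≤ (t * g + (h + b / 2)) ^ 2 := by
    nlinarith [sq_nonneg (w - (t * g + (h + b / 2)))]
  have e2 : (t * g + (h + b / 2)) ^ 2 ≤
      (t ^ 2 + θ) * g ^ 2 + (t ^ 2 / θ + 1) * (h + b / 2) ^ 2 := by
    have e : (t ^ 2 + θ) * g ^ 2 + (t ^ 2 / θ + 1) * (h + b / 2) ^ 2 - (t * g + (h + b / 2)) ^ 2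
      = (θ * g - t * (h + b / 2)) ^ 2 / θ := by field_simp; ring
    have : 0 ≤ (θ * g - t * (h + b / 2)) ^ 2 / θ := by positivity
    linarith
  have e3 : (t ^ 2 / θ + 1) * (h + b / 2) ^ 2 ≤ (t ^ 2 / θ + 1) * (2 * (h ^ 2 + b ^ 2)) := by
    apply mul_le_mul_of_nonneg_left _ (by positivity)
    nlinarith [sq_nonneg (h - b / 2), sq_nonneg b]
  have e4 := mul_le_mul_of_nonneg_right hK1 (by positivity : 0 ≤ h ^ 2 + b ^ 2)
  linarith

lemma coord2 (t θ K b g h : ℝ) (hθ : 0 < θ) (hK2 : 2 / θ ≤ K) :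
    (2 * t - 1 - θ) * g ^ 2 - K * (h ^ 2 + b ^ 2) ≤
      b * g + (2 * (t * g + h) * g - g ^ 2) := by
  have e2 : -((b + 2 * h) * g) ≤ θ * g ^ 2 + (b + 2 * h) ^ 2 / (4 * θ) := by
    have e : θ * g ^ 2 + (b + 2 * h) ^ 2 / (4 * θ) + ((b + 2 * h) * g)
      = (2 * θ * g + (b + 2 * h)) ^ 2 / (4 * θ) := by field_simp; ring
    have : 0 ≤ (2 * θ * g + (b + 2 * h)) ^ 2 / (4 * θ) := by positivity
    linarith
  have e3 : (b + 2 * h) ^ 2 / (4 * θ) ≤ 2 / θ * (h ^ 2 + b ^ 2) := by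
    rw [div_mul_eq_mul_div, div_le_div_iff₀ (by positivity) hθ]
    have : (b + 2 * h) ^ 2 ≤ 8 * (h ^ 2 + b ^ 2) := by
      nlinarith [sq_nonneg (2 * b - h), sq_nonneg b, sq_nonneg h]
    nlinarith
  have e4 := mul_le_mul_of_nonneg_right hK2 (by positivity : 0 ≤ h ^ 2 + b ^ 2)
  linarith

lemma coord3 (t g h y : ℝ) : - (5 / 2) * y ^ 2 - 4 * t ^ 2 * g ^ 2 - 4 * h ^ 2 ≤
    2 * (t * g + h) * y - 2 * y ^ 2 := by
  nlinarith [sq_nonneg (2 * (t * g + h) + y), sq_nonneg (t * g - h)]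

lemma scalar_core (A B t θ K c p F s n le lu G H Y Q bw bg ww pw pg py : ℝ)
    (hAe : A = 2 * t - 1 - 2 * θ) (hBe : B = t ^ 2 + 2 * θ)
    (hA : 0 < A) (hB : 0 < B) (hK0 : 0 < K)
    (hc : c ≤ 1) (hc0 : 0 < c) (hc2 : 8 * K * c ^ 2 * t ^ 2 ≤ θ)
    (hs : 0 ≤ s) (hn : 3 ≤ n) (hb : Q ≤ c ^ 2 * s) (hy : Y ≤ s)
    (hle : p * F ≤ - le + bw) (hlu : F = - lu + bg) (hG : 0 ≤ G) (hH : 0 ≤ H)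
    (s1 : bw + (pw - ww) ≤ (t ^ 2 + θ) * G + K * (H + Q))
    (s2 : (2 * t - 1 - θ) * G - K * (H + Q) ≤ bg + (pg - G))
    (s3 : - (5 / 2) * Y - 4 * t ^ 2 * G - 4 * H ≤ py - 2 * Y) :
    (A * p - B) * F ≤ 9 * (A + B) * K * H +
      (-A * (le + (pw - ww)) + B * (lu + (pg - G))
        + 2 * (A + B) * K * c ^ 2 * (n * s + (py - 2 * Y))) := by
  have r1 : A * (p * F + le + (pw - ww)) ≤ A * ((B - θ) * G + K * (H + Q)) := by
    apply mul_le_mul_of_nonneg_left _ hA.le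
    have : B - θ = t ^ 2 + θ := by rw [hBe]; ring
    rw [this]; linarith
  have r2 : B * ((A + θ) * G - K * (H + Q)) ≤ B * (F + lu + (pg - G)) := by
    apply mul_le_mul_of_nonneg_left _ hB.le
    have : A + θ = 2 * t - 1 - θ := by rw [hAe]; ring
    rw [this]; linarith
  have hAB : 0 < (A + B) * K := by positivity
  have r3 : 2 * (A + B) * K * c ^ 2 * (s / 2 - 4 * t ^ 2 * G - 4 * H) ≤ 2 * (A + B) * K * c ^ 2 * (n * s + (py - 2 * Y)) := by
    apply mul_le_mul_of_nonneg_left _ (by positivity)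
    have : 3 * s ≤ n * s := mul_le_mul_of_nonneg_right hn hs
    linarith
  have r4 : (A + B) * K * Q ≤ (A + B) * K * (c ^ 2 * s) := mul_le_mul_of_nonneg_left hb hAB.le
  have r5 : ((A + B) * G) * (8 * K * c ^ 2 * t ^ 2) ≤ ((A + B) * G) * θ := mul_le_mul_of_nonneg_left hc2 (by positivity)
  have r6 : ((A + B) * K * H) * c ^ 2 ≤ ((A + B) * K * H) * 1 :=
    mul_le_mul_of_nonneg_left (by nlinarith) (by positivity)
  linarith

lemma algebra_core {ι : Type*} (S : Finset ι) (g h w b y : ι → ℝ) (t θ K c p F s n le lu : ℝ)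
    (hθ : 0 < θ) (hA : 0 < 2 * t - 1 - 2 * θ)
    (hK : K = 2 * (t ^ 2 / θ + 1) + 2 / θ) (hc : c ≤ 1) (hc0 : 0 < c) (hc2 : 8 * K * c ^ 2 * t ^ 2 ≤ θ)
    (hs : 0 ≤ s) (hn : 3 ≤ n)
    (hb : ∑ i ∈ S, b i ^ 2 ≤ c ^ 2 * s) (hy : ∑ i ∈ S, y i ^ 2 ≤ s)
    (hle : p * F ≤ - le + ∑ i ∈ S, b i * w i)
    (hlu : F = - lu + ∑ i ∈ S, b i * g i) :
    ((2 * t - 1 - 2 * θ) * p - (t ^ 2 + 2 * θ)) * F ≤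
      9 * ((2 * t - 1 - 2 * θ) + (t ^ 2 + 2 * θ)) * K * ∑ i ∈ S, h i ^ 2 +
      (-(2 * t - 1 - 2 * θ) * (le + ∑ i ∈ S, (2 * (t * g i + h i) * w i - w i ^ 2))
        + (t ^ 2 + 2 * θ) * (lu + ∑ i ∈ S, (2 * (t * g i + h i) * g i - g i ^ 2))
        + 2 * ((2 * t - 1 - 2 * θ) + (t ^ 2 + 2 * θ)) * K * c ^ 2 *
          (n * s + ∑ i ∈ S, (2 * (t * g i + h i) * y i - 2 * y i ^ 2))) := by
  obtain ⟨A, hAe⟩ : ∃ A, A = 2 * t - 1 - 2 * θ := ⟨_, rfl⟩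
  obtain ⟨B, hBe⟩ : ∃ B, B = t ^ 2 + 2 * θ := ⟨_, rfl⟩
  rw [← hAe] at hA
  rw [← hAe, ← hBe]
  have hB : 0 < B := by rw [hBe]; positivity
  have hK1 : 2 * (t ^ 2 / θ + 1) ≤ K := by rw [hK]; have : 0 < 2 / θ := by positivity
                                           linarith
  have hK2 : 2 / θ ≤ K := by rw [hK]; have : 0 ≤ t ^ 2 / θ := by positivity
                             linarith
  have hK0 : 0 < K := lt_of_lt_of_le (by positivity) hK1
  have s1 := Finset.sum_le_sum (s := S) (fun i _ => coord1 t θ K (b i) (w i) (g i) (h i) hθ hK1)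
  have s2 := Finset.sum_le_sum (s := S) (fun i _ => coord2 t θ K (b i) (g i) (h i) hθ hK2)
  have s3 := Finset.sum_le_sum (s := S) (fun i _ => coord3 t (g i) (h i) (y i))
  have hG : 0 ≤ ∑ i ∈ S, g i ^ 2 := Finset.sum_nonneg fun i _ => sq_nonneg _
  have hH : 0 ≤ ∑ i ∈ S, h i ^ 2 := Finset.sum_nonneg fun i _ => sq_nonneg _
  simp only [Finset.sum_add_distrib, Finset.sum_sub_distrib, ← Finset.mul_sum] at s1 s2 s3 ⊢
  exact scalar_core A B t θ K c p F s n le lu _ _ _ _ _ _ _ _ _ _ hAe hBe hA hB hK0 hc hc0 hc2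
    hs hn hb hy hle hlu hG hH s1 s2 s3
lemma integral_fderiv_zero {N : ℕ} (f : Euc N → ℝ) (hf : ContDiff ℝ 1 f)
    (hc : HasCompactSupport f) (v : Euc N) : ∫ x, fderiv ℝ f x v = 0 := by
  have hd : Continuous (fun x => fderiv ℝ f x v) :=
    (hf.continuous_fderiv one_ne_zero).clm_apply continuous_const
  have hcs : HasCompactSupport (fun x => fderiv ℝ f x v) := hc.fderiv_apply (𝕜 := ℝ) v
  have := integral_mul_fderiv_eq_neg_fderiv_mul_of_integrable (μ := (volume : Measure (Euc N)))
    (f := fun _ : Euc N => (1 : ℝ)) (g := f) (v := v) (by simp)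
    (by simpa using hd.integrable_of_hasCompactSupport hcs)
    (by simpa using hf.continuous.integrable_of_hasCompactSupport hc)
    (fun x _ => by fun_prop) (fun x _ => (hf.differentiable one_ne_zero) x)
  simpa using this

/-- partial derivative -/
def pd {N : ℕ} (i : Fin N) (f : Euc N → ℝ) (x : Euc N) : ℝ :=
  fderiv ℝ f x (EuclideanSpace.single i 1)

lemma lap_eq {N : ℕ} (u : Euc N → ℝ) (x : Euc N) : lap u x = ∑ i, pd i (pd i u) x := rfl

lemma adv_eq {N : ℕ} (a : Euc N → Euc N) (u : Euc N → ℝ) (x : Euc N) :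
    adv a u x = ∑ i, a x i * pd i u x := by
  have h : a x = ∑ i, a x i • EuclideanSpace.single i (1 : ℝ) := by
    ext j
    simp [Finset.sum_apply, Pi.single_apply]
  have h1 : adv a u x = fderiv ℝ u x (a x) := by
    rw [adv, real_inner_comm]
    simp [gradient]
  rw [h1]
  conv_lhs => rw [h]
  simp [pd]

lemma contDiff_pd {N : ℕ} {u : Euc N → ℝ} (hu : ContDiff ℝ (⊤ : ℕ∞) u) (i : Fin N) :
    ContDiff ℝ (⊤ : ℕ∞) (pd i u) := by
  have h : ContDiff ℝ (⊤ : ℕ∞) (fderiv ℝ u) := hu.fderiv_right (by simp)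
  exact h.clm_apply contDiff_const

/-- restriction to a line -/
lemma line_deriv {N : ℕ} {f : Euc N → ℝ} {x : Euc N} (hf : DifferentiableAt ℝ f x) (i : Fin N) :
    HasDerivAt (fun s : ℝ => f (x + s • EuclideanSpace.single i 1)) (pd i f x) 0 :=
  hf.hasFDerivAt.hasLineDerivAt _

lemma one_dim (A B D t : ℝ) (U P E U1 E1 X r : ℝ → ℝ) (u' p' e' u1' e1' x' r' : ℝ)
    (hU : HasDerivAt U u' 0) (hP : HasDerivAt P p' 0) (hE : HasDerivAt E e' 0)
    (hU1 : HasDerivAt U1 u1' 0) (hE1 : HasDerivAt E1 e1' 0) (hX : HasDerivAt X x' 0)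
    (hr : HasDerivAt r r' 0) (hU0 : 0 < U 0) (hE0 : 0 < E 0) (hr0 : 0 < 1 + r 0) :
    HasDerivAt (fun s => (U s ^ t * P s) ^ 2 *
        (-A * (E1 s / E s) + B * (U1 s / U s) + D * (X s / (1 + r s))))
      (2 * (U 0 ^ t * P 0) * (t * (U 0 ^ t * P 0 * (u' / U 0)) + U 0 ^ t * p') *
        (-A * (E1 0 / E 0) + B * (U1 0 / U 0) + D * (X 0 / (1 + r 0))) +
       (U 0 ^ t * P 0) ^ 2 * (-A * (e1' / E 0 - E1 0 * e' / E 0 ^ 2)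
        + B * (u1' / U 0 - U1 0 * u' / U 0 ^ 2)
        + D * (x' / (1 + r 0) - X 0 * r' / (1 + r 0) ^ 2))) 0 := by
  have h1 := (((hU.rpow_const (p := t) (Or.inl hU0.ne')).mul hP).pow 2).mul
    ((((hE1.div hE hE0.ne').const_mul (-A)).add ((hU1.div hU hU0.ne').const_mul B)).add
      ((hX.div (hr.const_add 1) hr0.ne').const_mul D))
  refine HasDerivAt.congr_deriv h1 ?_
  simp only [Pi.mul_apply, Pi.div_apply, Pi.add_apply, Pi.pow_apply]
  rw [Real.rpow_sub_one hU0.ne']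
  field_simp
  ring

/-- The vector field whose divergence is integrated. -/
def Wf {N : ℕ} (A B D t : ℝ) (u E ψ : Euc N → ℝ) (i : Fin N) (x : Euc N) : ℝ :=
  (u x ^ t * ψ x) ^ 2 *
    (-A * (pd i E x / E x) + B * (pd i u x / u x) + D * (x i / (1 + ‖x‖ ^ 2)))

lemma Wf_contDiff {N : ℕ} (A B D t : ℝ) (u E ψ : Euc N → ℝ) (i : Fin N)
    (hu : ContDiff ℝ (⊤ : ℕ∞) u) (hE : ContDiff ℝ (⊤ : ℕ∞) E) (hψ : ContDiff ℝ (⊤ : ℕ∞) ψ)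
    (hu0 : ∀ x, 0 < u x) (hE0 : ∀ x, 0 < E x) :
    ContDiff ℝ (⊤ : ℕ∞) (Wf A B D t u E ψ i) := by
  have hx : ContDiff ℝ (⊤ : ℕ∞) (fun x : Euc N => x i) :=
    (EuclideanSpace.proj (𝕜 := ℝ) i).contDiff
  have h1 : ContDiff ℝ (⊤ : ℕ∞) (fun x => u x ^ t) :=
    hu.rpow_const_of_ne (fun x => (hu0 x).ne')
  have h2 : ContDiff ℝ (⊤ : ℕ∞) (fun x : Euc N => 1 + ‖x‖ ^ 2) :=
    contDiff_const.add (contDiff_norm_sq ℝ)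
  unfold Wf
  refine ((h1.mul hψ).pow 2).mul (((contDiff_const.mul ?_).add (contDiff_const.mul ?_)).add
    (contDiff_const.mul ?_))
  · exact (contDiff_pd hE i).div hE (fun x => (hE0 x).ne')
  · exact (contDiff_pd hu i).div hu (fun x => (hu0 x).ne')
  · exact hx.div h2 (fun x => by positivity)

lemma Wf_pd {N : ℕ} (A B D t : ℝ) (u E ψ : Euc N → ℝ) (i : Fin N)
    (hu : ContDiff ℝ (⊤ : ℕ∞) u) (hE : ContDiff ℝ (⊤ : ℕ∞) E) (hψ : ContDiff ℝ (⊤ : ℕ∞) ψ)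
    (hu0 : ∀ x, 0 < u x) (hE0 : ∀ x, 0 < E x) (x : Euc N) :
    pd i (Wf A B D t u E ψ i) x =
      2 * (u x ^ t * ψ x) * (t * (u x ^ t * ψ x * (pd i u x / u x)) + u x ^ t * pd i ψ x) *
        (-A * (pd i E x / E x) + B * (pd i u x / u x) + D * (x i / (1 + ‖x‖ ^ 2))) +
       (u x ^ t * ψ x) ^ 2 * (-A * (pd i (pd i E) x / E x - pd i E x * pd i E x / E x ^ 2)
        + B * (pd i (pd i u) x / u x - pd i u x * pd i u x / u x ^ 2)
        + D * (1 / (1 + ‖x‖ ^ 2) - x i * (2 * x i) / (1 + ‖x‖ ^ 2) ^ 2)) := by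
  have hd : ∀ {f : Euc N → ℝ}, ContDiff ℝ (⊤ : ℕ∞) f → DifferentiableAt ℝ f x :=
    fun hf => (hf.differentiable (by simp)) x
  have hX : HasDerivAt (fun s : ℝ => (x + s • EuclideanSpace.single i (1 : ℝ)) i) 1 0 := by
    simpa using (hasDerivAt_id (0 : ℝ)).const_add (x i)
  have hr : HasDerivAt (fun s : ℝ => ‖x + s • EuclideanSpace.single i (1 : ℝ)‖ ^ 2) (2 * x i) 0 := by
    have := (hasStrictFDerivAt_norm_sq x).hasFDerivAt.hasLineDerivAt (EuclideanSpace.single i (1 : ℝ))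
    have e : (2 • (innerSL ℝ x)) (EuclideanSpace.single i (1 : ℝ)) = 2 * x i := by
      simp [EuclideanSpace.inner_single_right]
    rw [e] at this
    exact this
  have h1 := one_dim A B D t _ _ _ _ _ _ _ _ _ _ _ _ _ _ (line_deriv (hd hu) i)
    (line_deriv (hd hψ) i) (line_deriv (hd hE) i) (line_deriv (hd (contDiff_pd hu i)) i)
    (line_deriv (hd (contDiff_pd hE i)) i) hX hr (hu0 _) (hE0 _) (by positivity)
  have h2 := line_deriv (hd (Wf_contDiff A B D t u E ψ i hu hE hψ hu0 hE0)) i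
  have h3 := h2.unique h1
  simpa only [zero_smul, add_zero] using h3

lemma key_pointwise {N : ℕ} (hN : 3 ≤ N) (p t θ K c C : ℝ)
    (hθ : 0 < θ) (hA : 0 < 2 * t - 1 - 2 * θ)
    (hK : K = 2 * (t ^ 2 / θ + 1) + 2 / θ) (hc : c ≤ 1) (hc0 : 0 < c)
    (hc2 : 8 * K * c ^ 2 * t ^ 2 ≤ θ)
    (a : Euc N → Euc N) (u E ψ : Euc N → ℝ) (hC0 : 0 < C) (hC : C ≤ c)
    (ha : ∀ x, ‖a x‖ ≤ C / (‖x‖ + 1))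
    (hu : ContDiff ℝ (⊤ : ℕ∞) u) (hE : ContDiff ℝ (⊤ : ℕ∞) E) (hψ : ContDiff ℝ (⊤ : ℕ∞) ψ)
    (hu0 : ∀ x, 0 < u x) (hE0 : ∀ x, 0 < E x)
    (hequ : ∀ x, -lap u x + adv a u x = u x ^ p)
    (heqE : ∀ x, p * u x ^ (p - 1) * E x ≤ -lap E x + adv a E x) (x : Euc N) :
    ((2 * t - 1 - 2 * θ) * p - (t ^ 2 + 2 * θ)) * (u x ^ (p - 1) * (u x ^ t * ψ x) ^ 2) ≤
      9 * ((2 * t - 1 - 2 * θ) + (t ^ 2 + 2 * θ)) * K * ∑ i, (u x ^ t * pd i ψ x) ^ 2 +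
      ∑ i, pd i (Wf (2 * t - 1 - 2 * θ) (t ^ 2 + 2 * θ)
        (2 * ((2 * t - 1 - 2 * θ) + (t ^ 2 + 2 * θ)) * K * c ^ 2) t u E ψ i) x := by
  have hup := hu0 x
  have hEp := hE0 x
  set φ := u x ^ t * ψ x with hφ
  have hR : 0 < 1 + ‖x‖ ^ 2 := by positivity
  have hxs : ∑ i, x i ^ 2 = ‖x‖ ^ 2 := by rw [EuclideanSpace.real_norm_sq_eq]
  have has : ∑ i, a x i ^ 2 = ‖a x‖ ^ 2 := by rw [EuclideanSpace.real_norm_sq_eq]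
  have hs : 0 ≤ φ ^ 2 / (1 + ‖x‖ ^ 2) := by positivity
  have hb : ∑ i, (φ * a x i) ^ 2 ≤ c ^ 2 * (φ ^ 2 / (1 + ‖x‖ ^ 2)) := by
    simp only [mul_pow, ← Finset.mul_sum, has]
    have h1 : ‖a x‖ ^ 2 ≤ c ^ 2 / (1 + ‖x‖ ^ 2) := by
      calc ‖a x‖ ^ 2 ≤ (C / (‖x‖ + 1)) ^ 2 := by gcongr; exact ha x
        _ = C ^ 2 / (‖x‖ + 1) ^ 2 := by rw [div_pow]
        _ ≤ c ^ 2 / (1 + ‖x‖ ^ 2) := by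
          gcongr
          nlinarith [norm_nonneg x]
    calc φ ^ 2 * ‖a x‖ ^ 2 ≤ φ ^ 2 * (c ^ 2 / (1 + ‖x‖ ^ 2)) := by gcongr
      _ = _ := by ring
  have hy : ∑ i, (φ * (x i / (1 + ‖x‖ ^ 2))) ^ 2 ≤ φ ^ 2 / (1 + ‖x‖ ^ 2) := by
    simp only [mul_pow, div_pow, ← Finset.mul_sum, ← Finset.sum_div, hxs]
    rw [div_eq_mul_inv (φ ^ 2)]
    apply mul_le_mul_of_nonneg_left _ (sq_nonneg _)
    rw [div_le_iff₀ (by positivity)]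
    field_simp
    linarith
  have hle : p * (u x ^ (p - 1) * φ ^ 2) ≤
      -(φ ^ 2 * (lap E x / E x)) + ∑ i, (φ * a x i) * (φ * (pd i E x / E x)) := by
    have h := heqE x
    rw [adv_eq] at h
    have e : ∑ i, (φ * a x i) * (φ * (pd i E x / E x)) = φ ^ 2 * ((∑ i, a x i * pd i E x) / E x) := by
      rw [Finset.sum_div, Finset.mul_sum]
      exact Finset.sum_congr rfl fun i _ => by ring
    rw [e]
    have h' : p * u x ^ (p - 1) ≤ (-lap E x + ∑ i, a x i * pd i E x) / E x := by
      rwa [le_div_iff₀ hEp]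
    have := mul_le_mul_of_nonneg_left h' (sq_nonneg φ)
    rw [add_div, neg_div] at this
    linarith
  have hlu : u x ^ (p - 1) * φ ^ 2 =
      -(φ ^ 2 * (lap u x / u x)) + ∑ i, (φ * a x i) * (φ * (pd i u x / u x)) := by
    have h := hequ x
    rw [adv_eq] at h
    have e : ∑ i, (φ * a x i) * (φ * (pd i u x / u x)) = φ ^ 2 * ((∑ i, a x i * pd i u x) / u x) := by
      rw [Finset.sum_div, Finset.mul_sum]
      exact Finset.sum_congr rfl fun i _ => by ring
    rw [e, Real.rpow_sub_one hup.ne', ← h]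
    ring
  have hn : (3 : ℝ) ≤ N := by exact_mod_cast hN
  have key := algebra_core Finset.univ (fun i => φ * (pd i u x / u x)) (fun i => u x ^ t * pd i ψ x)
    (fun i => φ * (pd i E x / E x)) (fun i => φ * a x i) (fun i => φ * (x i / (1 + ‖x‖ ^ 2)))
    t θ K c p _ _ N _ _ hθ hA hK hc hc0 hc2 hs hn hb hy hle hlu
  refine key.trans (le_of_eq ?_)
  congr 1
  simp only [Wf_pd _ _ _ t u E ψ _ hu hE hψ hu0 hE0, ← hφ]
  generalize 2 * ((2 * t - 1 - 2 * θ) + (t ^ 2 + 2 * θ)) * K * c ^ 2 = D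
  generalize (2 * t - 1 - 2 * θ) = A
  generalize t ^ 2 + 2 * θ = B
  have e1 : φ ^ 2 * (lap E x / E x) = ∑ i, φ ^ 2 * (pd i (pd i E) x / E x) := by
    rw [lap_eq, Finset.sum_div, Finset.mul_sum]
  have e2 : φ ^ 2 * (lap u x / u x) = ∑ i, φ ^ 2 * (pd i (pd i u) x / u x) := by
    rw [lap_eq, Finset.sum_div, Finset.mul_sum]
  have e3 : (N : ℝ) * (φ ^ 2 / (1 + ‖x‖ ^ 2)) = ∑ i : Fin N, (φ ^ 2 / (1 + ‖x‖ ^ 2)) := by simp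
  rw [e1, e2, e3]
  simp only [← Finset.sum_add_distrib, Finset.mul_sum]
  refine Finset.sum_congr rfl fun i _ => ?_
  generalize 1 + ‖x‖ ^ 2 = R
  ring

lemma pd_hasCompactSupport {N : ℕ} {f : Euc N → ℝ} (h : HasCompactSupport f) (i : Fin N) :
    HasCompactSupport (pd i f) := h.fderiv_apply (𝕜 := ℝ) _

lemma key_integral {N : ℕ} (hN : 3 ≤ N) (p t : ℝ) (ht : 1 < t) (htp : t ^ 2 < p * (2 * t - 1)) :
    ∃ c κ M : ℝ, 0 < c ∧ 0 < κ ∧ 0 < M ∧ ∀ (a : Euc N → Euc N) (u E ψ : Euc N → ℝ) (C : ℝ),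
    0 < C → C ≤ c → (∀ x, ‖a x‖ ≤ C / (‖x‖ + 1)) →
    ContDiff ℝ (⊤ : ℕ∞) u → ContDiff ℝ (⊤ : ℕ∞) E → ContDiff ℝ (⊤ : ℕ∞) ψ →
    HasCompactSupport ψ →
    (∀ x, 0 < u x) → (∀ x, 0 < E x) →
    (∀ x, -lap u x + adv a u x = u x ^ p) →
    (∀ x, p * u x ^ (p - 1) * E x ≤ -lap E x + adv a E x) →
    κ * ∫ x, u x ^ (p - 1) * (u x ^ t * ψ x) ^ 2 ≤ M * ∫ x, ∑ i, (u x ^ t * pd i ψ x) ^ 2 := by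
  obtain ⟨θ, hθ, hA, hκ⟩ : ∃ θ : ℝ, 0 < θ ∧ 0 < 2 * t - 1 - 2 * θ ∧
      0 < (2 * t - 1 - 2 * θ) * p - (t ^ 2 + 2 * θ) := by
    have h1 : ContinuousAt (fun θ : ℝ => 2 * t - 1 - 2 * θ) 0 := by fun_prop
    have h2 : ContinuousAt (fun θ : ℝ => (2 * t - 1 - 2 * θ) * p - (t ^ 2 + 2 * θ)) 0 := by fun_prop
    have e1 : ∀ᶠ θ in 𝓝 (0 : ℝ), 0 < 2 * t - 1 - 2 * θ :=
      h1.eventually (lt_mem_nhds (by simp; linarith))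
    have e2 : ∀ᶠ θ in 𝓝 (0 : ℝ), 0 < (2 * t - 1 - 2 * θ) * p - (t ^ 2 + 2 * θ) :=
      h2.eventually (lt_mem_nhds (by simp; linarith))
    have e3 : ∀ᶠ θ in 𝓝[>] (0 : ℝ), 0 < θ := eventually_mem_nhdsWithin
    obtain ⟨θ, h, h', h''⟩ := (e3.and ((e1.and e2).filter_mono nhdsWithin_le_nhds)).exists
    exact ⟨θ, h, h', h''⟩
  obtain ⟨K, hK⟩ : ∃ K, K = 2 * (t ^ 2 / θ + 1) + 2 / θ := ⟨_, rfl⟩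
  have hK0 : 0 < K := by rw [hK]; positivity
  obtain ⟨c, hc0, hc, hc2⟩ : ∃ c : ℝ, 0 < c ∧ c ≤ 1 ∧ 8 * K * c ^ 2 * t ^ 2 ≤ θ := by
    have ht0 : 0 < t := by linarith
    refine ⟨min 1 (θ / (8 * K * t ^ 2)), by positivity, min_le_left _ _, ?_⟩
    set c := min 1 (θ / (8 * K * t ^ 2))
    have h0 : 0 < c := by positivity
    have h1 : c ≤ 1 := min_le_left _ _
    have h2 : c ≤ θ / (8 * K * t ^ 2) := min_le_right _ _
    rw [le_div_iff₀ (by positivity)] at h2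
    have : c * c ≤ c * 1 := mul_le_mul_of_nonneg_left h1 h0.le
    have : (c * c) * (8 * K * t ^ 2) ≤ c * (8 * K * t ^ 2) := by
      apply mul_le_mul_of_nonneg_right (by linarith) (by positivity)
    linarith
  refine ⟨c, _, 9 * ((2 * t - 1 - 2 * θ) + (t ^ 2 + 2 * θ)) * K, hc0, hκ, by positivity, ?_⟩
  intro a u E ψ C hC0 hC ha hu hE hψ hcs hu0 hE0 hequ heqE
  have hpt := key_pointwise hN p t θ K c C hθ hA hK hc hc0 hc2 a u E ψ hC0 hC ha hu hE hψ
    hu0 hE0 hequ heqE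
  generalize (2 * ((2 * t - 1 - 2 * θ) + (t ^ 2 + 2 * θ)) * K * c ^ 2) = D at hpt
  generalize ((2 * t - 1 - 2 * θ) * p - (t ^ 2 + 2 * θ)) = κ at hpt ⊢
  generalize 9 * ((2 * t - 1 - 2 * θ) + (t ^ 2 + 2 * θ)) * K = M at hpt ⊢
  generalize (2 * t - 1 - 2 * θ) = A at hpt
  generalize t ^ 2 + 2 * θ = B at hpt
  have hucont : ∀ q : ℝ, Continuous fun x => u x ^ q := fun q =>
    hu.continuous.rpow_const (fun x => Or.inl (hu0 x).ne')
  have I1 : Integrable fun x => u x ^ (p - 1) * (u x ^ t * ψ x) ^ 2 := by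
    apply Continuous.integrable_of_hasCompactSupport
    · exact (hucont _).mul (((hucont _).mul hψ.continuous).pow 2)
    · exact hcs.mono' (subset_closure.trans' (fun x hx => by
        simp only [Function.mem_support] at hx ⊢
        intro h; simp [h] at hx))
  have I2 : Integrable fun x => ∑ i, (u x ^ t * pd i ψ x) ^ 2 := by
    apply integrable_finsetSum
    intro i _
    apply Continuous.integrable_of_hasCompactSupport
    · exact ((hucont _).mul (contDiff_pd hψ i).continuous).pow 2
    · exact (pd_hasCompactSupport hcs i).mono' (subset_closure.trans' (fun x hx => by
        simp only [Function.mem_support] at hx ⊢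
        intro h; simp [h] at hx))
  have hWc : ∀ i, HasCompactSupport (Wf A B D t u E ψ i) := fun i =>
    hcs.mono' (subset_closure.trans' (fun x hx => by
        simp only [Function.mem_support, Wf] at hx ⊢
        intro h; simp [h] at hx))
  have hWd := fun i => Wf_contDiff A B D t u E ψ i hu hE hψ hu0 hE0
  have I3 : ∀ i, Integrable (pd i (Wf A B D t u E ψ i)) := fun i =>
    (contDiff_pd (hWd i) i).continuous.integrable_of_hasCompactSupport
      (pd_hasCompactSupport (hWc i) i)
  have I3' : Integrable fun x => ∑ i, pd i (Wf A B D t u E ψ i) x :=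
    integrable_finsetSum _ fun i _ => I3 i
  have hz : ∫ x, ∑ i, pd i (Wf A B D t u E ψ i) x = 0 := by
    rw [integral_finsetSum _ fun i _ => I3 i]
    exact Finset.sum_eq_zero fun i _ =>
      integral_fderiv_zero _ ((hWd i).of_le (by exact_mod_cast le_top)) (hWc i) _
  have hmono := integral_mono (I1.const_mul κ) ((I2.const_mul M).add I3') hpt
  simp only [Pi.add_apply] at hmono
  rw [integral_add (I2.const_mul M) I3', hz, integral_const_mul, integral_const_mul, add_zero] at hmono
  exact hmono

lemma young_aux (p t κ L U η : ℝ) (k : ℕ) (hp : 1 < p) (ht : 1 < t) (hκ : 0 < κ) (hL : 0 < L)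
    (hU : 0 < U) (h0 : 0 ≤ η) (h1 : η ≤ 1) (hk : 2 * t ≤ k * (p - 1)) :
    L * (U ^ t * η ^ k) ^ 2 ≤ κ * (U ^ (p - 1) * (U ^ t * η ^ (k + 1)) ^ 2) +
      L * (L / κ) ^ (2 * t / (p - 1)) := by
  have hp1 : 0 < p - 1 := by linarith
  have hZ : 0 ≤ L * (L / κ) ^ (2 * t / (p - 1)) := by positivity
  have hF : 0 ≤ κ * (U ^ (p - 1) * (U ^ t * η ^ (k + 1)) ^ 2) := by positivity
  rcases le_total (L / κ) (U ^ (p - 1) * η ^ 2) with h | h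
  · rw [div_le_iff₀ hκ] at h
    have := mul_le_mul_of_nonneg_right h (sq_nonneg (U ^ t * η ^ k))
    have e : U ^ (p - 1) * η ^ 2 * κ * (U ^ t * η ^ k) ^ 2
      = κ * (U ^ (p - 1) * (U ^ t * η ^ (k + 1)) ^ 2) := by ring
    linarith
  · have h2 : (U ^ (p - 1) * η ^ 2) ^ (2 * t / (p - 1)) ≤ (L / κ) ^ (2 * t / (p - 1)) :=
      Real.rpow_le_rpow (by positivity) h (by positivity)
    have h3 : (U ^ t * η ^ k) ^ 2 ≤ (U ^ (p - 1) * η ^ 2) ^ (2 * t / (p - 1)) := by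
      rw [Real.mul_rpow (by positivity) (by positivity), mul_pow, ← Real.rpow_mul hU.le]
      have e1 : (p - 1) * (2 * t / (p - 1)) = t * 2 := by field_simp
      have e2 : (U ^ t) ^ 2 = U ^ (t * 2) := by
        rw [Real.rpow_mul hU.le]; norm_cast
      rw [e1, e2]
      apply mul_le_mul_of_nonneg_left _ (by positivity)
      have e3 : (η ^ k) ^ 2 = η ^ ((k : ℝ) * 2) := by
        rw [Real.rpow_mul h0]; norm_cast
      have e4 : (η ^ 2) ^ (2 * t / (p - 1)) = η ^ (2 * (2 * t / (p - 1))) := by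
        rw [Real.rpow_mul h0]; norm_cast
      rw [e3, e4]
      rcases h0.eq_or_lt with hz | hz
      · rw [← hz, Real.zero_rpow, Real.zero_rpow]
        · positivity
        · have : (0 : ℝ) < k := by
            by_contra hcon
            have : (k : ℝ) * (p - 1) ≤ 0 := mul_nonpos_of_nonpos_of_nonneg (not_lt.mp hcon) hp1.le
            linarith
          positivity
      · apply Real.rpow_le_rpow_of_exponent_ge hz h1
        have : 2 * t / (p - 1) ≤ k := by rwa [div_le_iff₀ hp1]
        linarith
    have := mul_le_mul_of_nonneg_left (h3.trans h2) hL.le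
    linarith

lemma cutoff_exists (N : ℕ) : ∃ L : ℝ, 0 < L ∧ ∀ R : ℝ, 1 ≤ R → ∃ η : Euc N → ℝ,
    ContDiff ℝ (⊤ : ℕ∞) η ∧ HasCompactSupport η ∧ (∀ x, 0 ≤ η x) ∧ (∀ x, η x ≤ 1) ∧
    (∀ x ∈ Metric.closedBall (0 : Euc N) 1, η x = 1) ∧
    (∀ x ∉ Metric.closedBall (0 : Euc N) (2 * R), ∑ i, pd i η x ^ 2 = 0) ∧
    (∀ x, ∑ i, pd i η x ^ 2 ≤ L / R ^ 2) := by
  let χ : ContDiffBump (0 : Euc N) := ⟨1, 2, by norm_num, by norm_num⟩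
  have hχ : ContDiff ℝ (⊤ : ℕ∞) χ := χ.contDiff
  have hχc : HasCompactSupport (χ : Euc N → ℝ) := χ.hasCompactSupport
  have hcont : Continuous fun x => ∑ i, pd i χ x ^ 2 :=
    continuous_finsetSum _ fun i _ => ((contDiff_pd hχ i).continuous).pow 2
  have hz : ∀ x ∉ Metric.closedBall (0 : Euc N) 2, ∀ i, pd i χ x = 0 := by
    intro x hx i
    have h1 : x ∉ tsupport (χ : Euc N → ℝ) := by rw [χ.tsupport_eq]; exact hx
    have h2 : fderiv ℝ χ x = 0 := fderiv_of_notMem_tsupport ℝ h1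
    simp [pd, h2]
  obtain ⟨L, hL⟩ := (isCompact_closedBall (0 : Euc N) 2).exists_bound_of_continuousOn hcont.continuousOn
  have hb : ∀ x, ∑ i, pd i χ x ^ 2 ≤ |L| + 1 := by
    intro x
    by_cases hx : x ∈ Metric.closedBall (0 : Euc N) 2
    · have := (le_abs_self _).trans ((hL x hx).trans (le_abs_self L))
      linarith
    · simp [hz x hx]; positivity
  refine ⟨|L| + 1, by positivity, fun R hR => ?_⟩
  have hR0 : 0 < R := by linarith
  have hpd : ∀ i x, pd i (fun y => χ (R⁻¹ • y)) x = R⁻¹ * pd i χ (R⁻¹ • x) := by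
    intro i x
    simp [pd, fderiv_comp_smul]
  refine ⟨fun x => χ (R⁻¹ • x), hχ.comp (contDiff_const_smul _), ?_, fun x => χ.nonneg,
    fun x => χ.le_one, ?_, ?_, ?_⟩
  · exact hχc.comp_smul (inv_ne_zero hR0.ne')
  · intro x hx
    apply χ.one_of_mem_closedBall
    simp only [mem_closedBall_zero_iff, norm_smul, norm_inv, Real.norm_eq_abs, abs_of_pos hR0] at hx ⊢
    show R⁻¹ * ‖x‖ ≤ 1
    rw [inv_mul_le_iff₀ hR0]; linarith
  · intro x hx
    have : R⁻¹ • x ∉ Metric.closedBall (0 : Euc N) 2 := by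
      simp only [mem_closedBall_zero_iff, norm_smul, norm_inv, Real.norm_eq_abs, abs_of_pos hR0] at hx ⊢
      rw [inv_mul_le_iff₀ hR0]; linarith
    simp [hpd, hz _ this]
  · intro x
    simp only [hpd, mul_pow, ← Finset.mul_sum]
    have := mul_le_mul_of_nonneg_left (hb (R⁻¹ • x)) (by positivity : 0 ≤ R⁻¹ ^ 2)
    refine this.trans (le_of_eq ?_)
    field_simp

lemma conclude {N : ℕ} (p t κ M : ℝ) (hp : 1 < p) (ht : 1 < t) (hκ : 0 < κ) (hM : 0 < M)
    (hNt : (N : ℝ) < 2 + 4 * t / (p - 1)) (u : Euc N → ℝ)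
    (hu : ContDiff ℝ (⊤ : ℕ∞) u) (hu0 : ∀ x, 0 < u x)
    (H : ∀ ψ : Euc N → ℝ, ContDiff ℝ (⊤ : ℕ∞) ψ → HasCompactSupport ψ →
      κ * ∫ x, u x ^ (p - 1) * (u x ^ t * ψ x) ^ 2 ≤ M * ∫ x, ∑ i, (u x ^ t * pd i ψ x) ^ 2) :
    False := by
  have hp1 : 0 < p - 1 := by linarith
  obtain ⟨k, hk⟩ := exists_nat_ge (2 * t / (p - 1))
  rw [div_le_iff₀ hp1] at hk
  obtain ⟨L, hL, hcut⟩ := cutoff_exists N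
  obtain ⟨L0, hL0⟩ : ∃ L0, L0 = M * (k + 1) ^ 2 * L := ⟨_, rfl⟩
  have hL0p : 0 < L0 := by rw [hL0]; positivity
  obtain ⟨σ, hσ⟩ : ∃ σ, σ = 2 * t / (p - 1) := ⟨_, rfl⟩
  have hucont : ∀ q : ℝ, Continuous fun x => u x ^ q := fun q =>
    hu.continuous.rpow_const (fun x => Or.inl (hu0 x).ne')
  have hG : Continuous fun x => u x ^ (p - 1) * (u x ^ t) ^ 2 := (hucont _).mul ((hucont _).pow 2)
  have hδ : 0 < ∫ x in Metric.closedBall (0 : Euc N) 1, u x ^ (p - 1) * (u x ^ t) ^ 2 := by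
    rw [setIntegral_pos_iff_support_of_nonneg_ae]
    · have : (Function.support fun x => u x ^ (p - 1) * (u x ^ t) ^ 2) = Set.univ := by
        ext x
        have := hu0 x
        simp only [Function.mem_support, Set.mem_univ, iff_true]
        positivity
      rw [this, Set.univ_inter]
      exact Metric.measure_closedBall_pos _ _ one_pos
    · exact Eventually.of_forall fun x => by have := hu0 x; simp only [Pi.zero_apply]; positivity
    · exact hG.continuousOn.integrableOn_compact (isCompact_closedBall _ _)
  set δ := ∫ x in Metric.closedBall (0 : Euc N) 1, u x ^ (p - 1) * (u x ^ t) ^ 2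
  have main : ∀ R : ℝ, 1 ≤ R → κ / 2 * δ ≤
      (L0 / R ^ 2) * ((L0 / R ^ 2) / (κ / 2)) ^ σ * volume.real (Metric.closedBall (0 : Euc N) (2 * R)) := by
    intro R hR
    have hR0 : 0 < R := by linarith
    obtain ⟨η, hη, hηc, h0, h1, hone, hz, hgr⟩ := hcut R hR
    have hψ : ContDiff ℝ (⊤ : ℕ∞) fun x => η x ^ (k + 1) := hη.pow _
    have hψc : HasCompactSupport fun x => η x ^ (k + 1) :=
      hηc.mono' (subset_closure.trans' (fun x hx => by
        simp only [Function.mem_support] at hx ⊢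
        intro h; simp [h] at hx))
    have hH := H _ hψ hψc
    have hpd : ∀ x i, pd i (fun x => η x ^ (k + 1)) x = (k + 1) * η x ^ k * pd i η x := by
      intro x i
      have hd : DifferentiableAt ℝ η x := (hη.differentiable (by simp)) x
      have := ((hd.hasFDerivAt).pow (k + 1)).fderiv
      simp only [pd]
      erw [this]
      simp
    set Z := (L0 / R ^ 2) * ((L0 / R ^ 2) / (κ / 2)) ^ σ with hZ
    have hZ0 : 0 ≤ Z := by positivity
    set S := Metric.closedBall (0 : Euc N) (2 * R) with hS
    have hSm : MeasurableSet S := Metric.isClosed_closedBall.measurableSet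
    have hSf : volume S ≠ ⊤ := (isCompact_closedBall _ _).measure_ne_top
    have I1 : Integrable fun x => u x ^ (p - 1) * (u x ^ t * η x ^ (k + 1)) ^ 2 := by
      apply Continuous.integrable_of_hasCompactSupport
      · exact (hucont _).mul (((hucont _).mul hψ.continuous).pow 2)
      · exact hψc.mono' (subset_closure.trans' (fun x hx => by
          simp only [Function.mem_support] at hx ⊢
          intro h; simp [h] at hx))
    have I2 : Integrable fun x => ∑ i, (u x ^ t * pd i (fun x => η x ^ (k + 1)) x) ^ 2 := by
      apply integrable_finsetSum
      intro i _
      apply Continuous.integrable_of_hasCompactSupport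
      · exact ((hucont _).mul (contDiff_pd hψ i).continuous).pow 2
      · exact (pd_hasCompactSupport hψc i).mono' (subset_closure.trans' (fun x hx => by
          simp only [Function.mem_support] at hx ⊢
          intro h; simp [h] at hx))
    have I3 : Integrable (S.indicator fun _ => Z) :=
      (integrable_indicator_iff hSm).mpr (integrableOn_const hSf)
    have hpt : ∀ x, M * ∑ i, (u x ^ t * pd i (fun x => η x ^ (k + 1)) x) ^ 2 ≤
        κ / 2 * (u x ^ (p - 1) * (u x ^ t * η x ^ (k + 1)) ^ 2) + S.indicator (fun _ => Z) x := by
      intro x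
      have hux := hu0 x
      have e : M * ∑ i, (u x ^ t * pd i (fun x => η x ^ (k + 1)) x) ^ 2
          = M * (k + 1) ^ 2 * (∑ i, pd i η x ^ 2) * (u x ^ t * η x ^ k) ^ 2 := by
        simp only [hpd, Finset.mul_sum, Finset.sum_mul]
        exact Finset.sum_congr rfl fun i _ => by ring
      rw [e]
      by_cases hx : x ∈ S
      · rw [Set.indicator_of_mem hx]
        have hy := young_aux p t (κ / 2) (L0 / R ^ 2) (u x) (η x) k hp ht (by positivity)
          (by positivity) hux (h0 x) (h1 x) hk
        rw [← hσ] at hy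
        refine le_trans ?_ hy
        apply mul_le_mul_of_nonneg_right _ (sq_nonneg _)
        have := mul_le_mul_of_nonneg_left (hgr x) (by positivity : 0 ≤ M * ((k : ℝ) + 1) ^ 2)
        rw [hL0]
        refine this.trans (le_of_eq ?_)
        ring
      · rw [Set.indicator_of_notMem hx, hz x hx]
        have : 0 ≤ u x ^ (p - 1) * (u x ^ t * η x ^ (k + 1)) ^ 2 := by positivity
        nlinarith
    have hineq := integral_mono (I2.const_mul M) ((I1.const_mul (κ / 2)).add I3) hpt
    simp only [Pi.add_apply] at hineq
    rw [integral_add (I1.const_mul _) I3, integral_const_mul, integral_const_mul,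
      integral_indicator hSm, setIntegral_const, smul_eq_mul] at hineq
    have hlow : δ ≤ ∫ x, u x ^ (p - 1) * (u x ^ t * η x ^ (k + 1)) ^ 2 := by
      have e : δ = ∫ x in Metric.closedBall (0 : Euc N) 1,
          u x ^ (p - 1) * (u x ^ t * η x ^ (k + 1)) ^ 2 := by
        apply setIntegral_congr_fun Metric.isClosed_closedBall.measurableSet
        intro x hx
        simp [hone x hx]
      rw [e]
      exact setIntegral_le_integral I1 (Eventually.of_forall fun x => by
        have := hu0 x; simp only [Pi.zero_apply]; positivity)
    have := mul_le_mul_of_nonneg_left hlow (by positivity : 0 ≤ κ / 2)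
    linarith
  -- the limit
  have hlim : Tendsto (fun R : ℝ => (L0 * (L0 / (κ / 2)) ^ σ * (2 ^ N * volume.real (Metric.ball (0 : Euc N) 1)))
      * R ^ (-(2 + 2 * σ - N))) atTop (𝓝 0) := by
    have := (tendsto_rpow_neg_atTop (y := 2 + 2 * σ - N) (by rw [hσ]; ring_nf at hNt ⊢; linarith)).const_mul
      (L0 * (L0 / (κ / 2)) ^ σ * (2 ^ N * volume.real (Metric.ball (0 : Euc N) 1)))
    simpa using this
  have hev := hlim.eventually (gt_mem_nhds (by positivity : 0 < κ / 2 * δ))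
  obtain ⟨R, hR1, hR⟩ := (hev.and (eventually_ge_atTop 1)).exists
  have hR0 : 0 < R := by linarith
  have hm := main R hR
  have hv : volume.real (Metric.closedBall (0 : Euc N) (2 * R))
      = (2 * R) ^ N * volume.real (Metric.ball (0 : Euc N) 1) := by
    rw [Measure.addHaar_real_closedBall _ _ (by positivity)]
    simp
  have e : (L0 / R ^ 2) * ((L0 / R ^ 2) / (κ / 2)) ^ σ * volume.real (Metric.closedBall (0 : Euc N) (2 * R))
      = (L0 * (L0 / (κ / 2)) ^ σ * (2 ^ N * volume.real (Metric.ball (0 : Euc N) 1)))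
      * R ^ (-(2 + 2 * σ - N)) := by
    rw [hv]
    have e1 : (L0 / R ^ 2) / (κ / 2) = (L0 / (κ / 2)) * (R ^ 2)⁻¹ := by field_simp
    have e2 : ((R ^ 2)⁻¹) ^ σ = R ^ (-(2 * σ)) := by
      rw [Real.inv_rpow (by positivity), Real.rpow_neg hR0.le, Real.rpow_mul hR0.le]
      norm_cast
    have e3 : R ^ (-(2 + 2 * σ - N)) = (R ^ 2)⁻¹ * R ^ (-(2 * σ)) * R ^ N := by
      have : -(2 + 2 * σ - N) = -(2:ℝ) + (-(2 * σ)) + (N : ℝ) := by ring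
      rw [this, Real.rpow_add hR0, Real.rpow_add hR0, Real.rpow_natCast, Real.rpow_neg hR0.le]
      norm_cast
    rw [e1, Real.mul_rpow (by positivity) (by positivity), e2, e3, mul_pow]
    ring
  rw [e] at hm
  linarith

/-- For `3 ≤ N` and `1 < p` (with `p < p_c` when `N ≥ 11`) there
is a constant `C* > 0` (depending only on `N, p`) such that for any smooth
divergence-free vector field `a` with `|a(x)| ≤ C/(|x|+1)` for some `0 < C ≤ C*`,
the equation `-Δu + a·∇u = u^p` has no positive stable solution on ℝ^N. -/
theorem no_stable_solution_subcritical (N : ℕ) (hN : 3 ≤ N) (p : ℝ) (hp : 1 < p)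
    (hpc : 11 ≤ N → p < pJL N) :
    ∃ Cstar : ℝ, 0 < Cstar ∧
      ∀ (a : Euc N → Euc N), ContDiff ℝ (⊤ : ℕ∞) a → (∀ x, divg a x = 0) →
        ∀ C : ℝ, 0 < C → C ≤ Cstar → (∀ x, ‖a x‖ ≤ C / (‖x‖ + 1)) →
          ¬ ∃ u : Euc N → ℝ, IsStableSolution a p Set.univ u := by
  obtain ⟨t, ht, htp, hNt⟩ := param_exists N p hp hpc
  obtain ⟨c, κ, M, hc, hκ, hM, H⟩ := key_integral hN p t ht htp
  refine ⟨c, hc, ?_⟩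
  rintro a - - C hC0 hC ha ⟨u, ⟨hu, hu0, hequ⟩, E, hE, hE0, heqE⟩
  rw [contDiffOn_univ] at hu hE
  refine conclude p t κ M hp ht hκ hM hNt u hu (fun x => hu0 x trivial) fun ψ hψ hψc => ?_
  exact H a u E ψ C hC0 hC ha hu hE hψ hψc (fun x => hu0 x trivial) (fun x => hE0 x trivial)
    (fun x => hequ x trivial) (fun x => heqE x trivial)
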